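/- arXiv:1406.5523 — 8 statements merged into one kernel-verified Lean document; each statement's English description precedes it below -/
import Mathlib

section
/- For all integers n and ℓ with 1 ≤ ℓ ≤ n and every complex number a, the polynomial f_{n,ℓ}(z) is monic of degree n, its coefficient of z^{n-j} vanishes for every j with 1 ≤ j ≤ ℓ-1, and its coefficient of z^{n-ℓ} equals -a^ℓ·binom(n, ℓ). In other words, f_{n,ℓ}(z) = z^n - a^ℓ·binom(n, ℓ)·z^{n-ℓ} + r(z) where r is a polynomial of degree at most n-ℓ-1. -/
open Polynomial

/-- `P n ℓ a` is the polynomial `P_{n,ℓ}(z) = ∑_{k=0}^{ℓ-1} C(n-ℓ+k, k) a^k z^{ℓ-1-k}`. -/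
noncomputable def P (n ℓ : ℕ) (a : ℂ) : Polynomial ℂ :=
  ∑ k ∈ Finset.range ℓ, C ((Nat.choose (n - ℓ + k) k : ℂ) * a ^ k) * X ^ (ℓ - 1 - k)

/-- `f n ℓ a` is the polynomial `f_{n,ℓ}(z) = (z - a)^{n-ℓ+1}·P_{n,ℓ}(z)`. -/
noncomputable def f (n ℓ : ℕ) (a : ℂ) : Polynomial ℂ :=
  (X - C a) ^ (n - ℓ + 1) * P n ℓ a

lemma P_succ (m s : ℕ) (a : ℂ) :
    P (m + (s + 2)) (s + 2) a = X * P (m + (s + 1)) (s + 1) a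
      + C ((Nat.choose (m + (s + 1)) (s + 1) : ℂ) * a ^ (s + 1)) := by
  unfold P
  rw [Finset.sum_range_succ, Finset.mul_sum]
  congr 1
  · refine Finset.sum_congr rfl fun k hk => ?_
    have hk' : k < s + 1 := Finset.mem_range.1 hk
    have e : s + 2 - 1 - k = (s + 1 - 1 - k) + 1 := by omega
    rw [e, pow_succ, Nat.add_sub_cancel m (s + 2), Nat.add_sub_cancel m (s + 1)]
    ring
  · simp

lemma P_one (m : ℕ) (a : ℂ) : P (m + 1) 1 a = 1 := by
  simp [P]

lemma P_rec (m s : ℕ) (a : ℂ) :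
    (X - C a) * P (m + 1 + (s + 1)) (s + 1) a = X * P (m + (s + 1)) (s + 1) a
      - C ((Nat.choose (m + s + 1) s : ℂ) * a ^ (s + 1)) := by
  induction s with
  | zero => simp [P_one]
  | succ s ih =>
    rw [P_succ, P_succ, mul_add, mul_left_comm, ih]
    have e : Nat.choose (m + 1 + (s + 1)) (s + 1)
        = Nat.choose (m + s + 1) s + Nat.choose (m + (s + 1)) (s + 1) := by
      rw [show m + 1 + (s + 1) = (m + s + 1) + 1 by ring, Nat.choose_succ_succ]
      rfl
    rw [show m + (s + 1) + 1 = m + 1 + (s + 1) by ring, e]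
    simp only [map_mul, map_pow, map_natCast, Nat.cast_add, map_add]
    ring

lemma P_zero (s : ℕ) (a : ℂ) :
    (X - C a) * P (0 + (s + 1)) (s + 1) a = X ^ (s + 1) - C (a ^ (s + 1)) := by
  induction s with
  | zero => rw [P_one]; simp
  | succ s ih =>
    rw [P_succ, mul_add, mul_left_comm, ih]
    simp
    ring

lemma f_form (m s : ℕ) (a : ℂ) : ∃ r : Polynomial ℂ, r.degree < m ∧
    f (m + (s + 1)) (s + 1) a = X ^ (m + s + 1)
      - C (a ^ (s + 1) * (Nat.choose (m + s + 1) (s + 1) : ℂ)) * X ^ m + r := by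
  induction m with
  | zero =>
    refine ⟨0, by simp, ?_⟩
    unfold f
    have := P_zero s a
    simp at this ⊢
    exact this
  | succ m ih =>
    obtain ⟨r, hr, h⟩ := ih
    have ht : ((X - C a) ^ (m + 1) - X ^ (m + 1) : Polynomial ℂ).degree < (m + 1 : ℕ) := by
      have hd : ((X - C a) ^ (m + 1) : Polynomial ℂ).degree = (m + 1 : ℕ) := by
        rw [degree_pow, degree_X_sub_C]; simp
      rw [← hd]
      refine degree_sub_lt_left ?_ ?_ ?_
      · rw [hd, degree_X_pow]
      · exact pow_ne_zero _ (X_sub_C_ne_zero a)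
      · rw [((monic_X_sub_C a).pow _).leadingCoeff, (monic_X_pow _).leadingCoeff]
    refine ⟨X * r - C ((Nat.choose (m + s + 1) s : ℂ) * a ^ (s + 1))
      * ((X - C a) ^ (m + 1) - X ^ (m + 1)), ?_, ?_⟩
    · refine lt_of_le_of_lt (degree_sub_le _ _) (max_lt ?_ ?_)
      · rw [← mem_degreeLT] at hr ⊢
        rw [mem_degreeLT, degree_lt_iff_coeff_zero] at *
        intro k hk
        obtain ⟨k, rfl⟩ : ∃ j, k = j + 1 := ⟨k - 1, by omega⟩
        rw [coeff_X_mul]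
        exact hr k (by omega)
      · rw [← smul_eq_C_mul]
        exact lt_of_le_of_lt (degree_smul_le _ _) ht
    · have hf : f (m + 1 + (s + 1)) (s + 1) a = X * f (m + (s + 1)) (s + 1) a
          - C ((Nat.choose (m + s + 1) s : ℂ) * a ^ (s + 1)) * (X - C a) ^ (m + 1) := by
        unfold f
        rw [Nat.add_sub_cancel, Nat.add_sub_cancel, pow_succ _ (m + 1), mul_assoc, P_rec]
        ring
      rw [hf, h, show m + 1 + s + 1 = (m + s + 1) + 1 by ring,
        Nat.choose_succ_succ (m + s + 1) s]
      simp only [map_mul, map_pow, map_natCast, Nat.cast_add, map_add, Nat.succ_eq_add_one]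
      ring

/-- For `1 ≤ ℓ ≤ n`, the polynomial `f_{n,ℓ}` is monic of degree `n`, its coefficients of
`z^{n-j}` vanish for `1 ≤ j ≤ ℓ - 1`, and its coefficient of `z^{n-ℓ}` is `-a^ℓ·binom(n,ℓ)`. -/
theorem f_expansion (n ℓ : ℕ) (hℓ : 1 ≤ ℓ) (hn : ℓ ≤ n) (a : ℂ) :
    (f n ℓ a).Monic ∧ (f n ℓ a).natDegree = n ∧
    (∀ j : ℕ, 1 ≤ j → j ≤ ℓ - 1 → (f n ℓ a).coeff (n - j) = 0) ∧
    (f n ℓ a).coeff (n - ℓ) = -(a ^ ℓ * (Nat.choose n ℓ : ℂ)) := by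
  obtain ⟨s, rfl⟩ : ∃ s, ℓ = s + 1 := ⟨ℓ - 1, by omega⟩
  obtain ⟨m, rfl⟩ : ∃ m, n = m + (s + 1) := ⟨n - (s + 1), by omega⟩
  obtain ⟨r, hr, h⟩ := f_form m s a
  have hr' := (degree_lt_iff_coeff_zero _ _).1 hr
  have hc : ∀ i, m ≤ i → (f (m + (s + 1)) (s + 1) a).coeff i = (if i = m + s + 1 then 1 else 0)
      - a ^ (s + 1) * (Nat.choose (m + s + 1) (s + 1) : ℂ) * (if i = m then 1 else 0) := by
    intro i hi
    rw [h, coeff_add, coeff_sub, coeff_C_mul, coeff_X_pow, coeff_X_pow, hr' i hi, add_zero]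
  have hle : (f (m + (s + 1)) (s + 1) a).natDegree ≤ m + (s + 1) := by
    rw [natDegree_le_iff_coeff_eq_zero]
    intro i hi
    rw [hc i (by omega), if_neg (by omega), if_neg (by omega)]
    simp
  have h1 : (f (m + (s + 1)) (s + 1) a).coeff (m + (s + 1)) = 1 := by
    rw [hc _ (by omega), if_pos (by omega), if_neg (by omega)]
    simp
  refine ⟨monic_of_natDegree_le_of_coeff_eq_one _ hle h1, ?_, ?_, ?_⟩
  · exact natDegree_eq_of_le_of_coeff_ne_zero hle (by rw [h1]; exact one_ne_zero)
  · intro j hj1 hj2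
    rw [hc _ (by omega), if_neg (by omega), if_neg (by omega)]
    simp
  · rw [Nat.add_sub_cancel, hc _ le_rfl, if_neg (by omega), if_pos rfl]
    simp [add_assoc]
end

section
/- For all integers n and ℓ with 1 ≤ ℓ ≤ n and every nonzero complex number a, one has P_{n,ℓ}(a) = a^{ℓ-1}·binom(n, ℓ-1) ≠ 0, and consequently a is a root of the polynomial f_{n,ℓ} of multiplicity exactly n - ℓ + 1 (the root multiplicity of a in f_{n,ℓ} equals n - ℓ + 1). -/
open Polynomial

theorem sum_choose_aux (d m : ℕ) :
    ∑ k ∈ Finset.range (m + 1), Nat.choose (d + k) k = Nat.choose (d + (m + 1)) m := by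
  induction m with
  | zero => simp
  | succ m ih =>
    rw [Finset.sum_range_succ, ih, ← add_assoc d (m + 1) 1, Nat.choose_succ_succ]

/-- For `1 ≤ ℓ ≤ n` and `a ≠ 0`, one has `P_{n,ℓ}(a) = a^{ℓ-1}·binom(n, ℓ-1) ≠ 0`, and `a`
is a root of `f_{n,ℓ}` of multiplicity exactly `n - ℓ + 1`. -/
theorem root_multiplicity_at_a (n ℓ : ℕ) (hℓ : 1 ≤ ℓ) (hn : ℓ ≤ n) (a : ℂ) (ha : a ≠ 0) :
    (P n ℓ a).eval a = a ^ (ℓ - 1) * (Nat.choose n (ℓ - 1) : ℂ) ∧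
    a ^ (ℓ - 1) * (Nat.choose n (ℓ - 1) : ℂ) ≠ 0 ∧
    (f n ℓ a).rootMultiplicity a = n - ℓ + 1 := by
  have h1 : (P n ℓ a).eval a = a ^ (ℓ - 1) * (Nat.choose n (ℓ - 1) : ℂ) := by
    obtain ⟨m, rfl⟩ : ∃ m, ℓ = m + 1 := ⟨ℓ - 1, by omega⟩
    obtain ⟨d, rfl⟩ : ∃ d, n = d + (m + 1) := ⟨n - (m + 1), by omega⟩
    simp only [P, Nat.add_sub_cancel, eval_finset_sum, eval_mul, eval_C, eval_pow, eval_X]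
    rw [← sum_choose_aux, Nat.cast_sum, Finset.mul_sum]
    refine Finset.sum_congr rfl fun k hk => ?_
    have hk' : k + (m - k) = m := by
      have := Finset.mem_range.mp hk
      omega
    rw [mul_assoc, ← pow_add, hk', mul_comm]
  have h2 : a ^ (ℓ - 1) * (Nat.choose n (ℓ - 1) : ℂ) ≠ 0 :=
    mul_ne_zero (pow_ne_zero _ ha)
      (Nat.cast_ne_zero.mpr (Nat.choose_pos (by omega)).ne')
  refine ⟨h1, h2, ?_⟩
  have h3 : ¬ IsRoot (P n ℓ a) a := by
    rw [IsRoot, h1]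
    exact h2
  have h4 : P n ℓ a ≠ 0 := by
    intro h
    apply h3
    simp [h]
  rw [f, mul_comm, rootMultiplicity_mul_X_sub_C_pow h4, rootMultiplicity_eq_zero h3, zero_add]
end

section
/- For all integers n and ℓ with 1 ≤ ℓ ≤ n and every nonzero complex number a, the derivative of f_{n,ℓ} factors as f_{n,ℓ}'(z) = (z - a)^{n-ℓ}·g_{n,ℓ}(z), where g_{n,ℓ}(z) = (n-ℓ+1)·P_{n,ℓ}(z) + (z - a)·P_{n,ℓ}'(z) is a polynomial of degree exactly ℓ - 1 (with leading coefficient n) satisfying g_{n,ℓ}(a) ≠ 0; hence f_{n,ℓ} has, besides a, exactly ℓ - 1 critical points in ℂ counted with multiplicity. -/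
open Polynomial

/-- `g n ℓ a` is the polynomial `g_{n,ℓ}(z) = (n-ℓ+1)·P_{n,ℓ}(z) + (z-a)·P_{n,ℓ}'(z)`. -/
noncomputable def g (n ℓ : ℕ) (a : ℂ) : Polynomial ℂ :=
  C ((n - ℓ + 1 : ℕ) : ℂ) * P n ℓ a + (X - C a) * derivative (P n ℓ a)

/-- For `1 ≤ ℓ ≤ n` and `a ≠ 0`, the derivative of `f_{n,ℓ}` factors as
`f_{n,ℓ}'(z) = (z-a)^{n-ℓ}·g_{n,ℓ}(z)`, where `g_{n,ℓ}` has degree exactly `ℓ - 1` with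
leading coefficient `n` and `g_{n,ℓ}(a) ≠ 0`; hence besides `a` the polynomial `f_{n,ℓ}`
has exactly `ℓ - 1` critical points counted with multiplicity (the roots of `g_{n,ℓ}`). -/
theorem derivative_f_factorization (n ℓ : ℕ) (hℓ : 1 ≤ ℓ) (hn : ℓ ≤ n) (a : ℂ) (ha : a ≠ 0) :
    derivative (f n ℓ a) = (X - C a) ^ (n - ℓ) * g n ℓ a ∧
    (g n ℓ a).natDegree = ℓ - 1 ∧
    (g n ℓ a).leadingCoeff = (n : ℂ) ∧
    (g n ℓ a).eval a ≠ 0 ∧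
    Multiset.card (g n ℓ a).roots = ℓ - 1 := by
  obtain ⟨m, rfl⟩ : ∃ m, ℓ = m + 1 := ⟨ℓ - 1, by omega⟩
  have hPdeg : (P n (m + 1) a).natDegree ≤ m := by
    unfold P
    apply natDegree_sum_le_of_forall_le
    intro k _
    refine (natDegree_C_mul_X_pow_le _ _).trans ?_
    omega
  have hPm : (P n (m + 1) a).coeff m = 1 := by
    unfold P
    rw [finset_sum_coeff, Finset.sum_eq_single 0]
    · simp
    · intro k hk hk0
      have := Finset.mem_range.mp hk
      rw [coeff_C_mul_X_pow, if_neg (by omega)]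
    · simp
  have hPm1 : (P n (m + 1) a).coeff (m + 1) = 0 :=
    coeff_eq_zero_of_natDegree_lt (by omega)
  have hd : (derivative (P n (m + 1) a)).natDegree ≤ m - 1 :=
    (natDegree_derivative_le _).trans (by omega)
  have hgdeg : (g n (m + 1) a).natDegree ≤ m := by
    unfold g
    refine natDegree_add_le_of_degree_le ((natDegree_C_mul_le _ _).trans hPdeg) ?_
    rcases Nat.eq_zero_or_pos m with h0 | h0
    · subst h0
      rw [derivative_of_natDegree_zero (by omega)]
      simp
    · refine natDegree_mul_le.trans ?_
      rw [natDegree_X_sub_C]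
      omega
  have hgm : (g n (m + 1) a).coeff m = (n : ℂ) := by
    have hnc : ((n - (m + 1) + 1 : ℕ) : ℂ) + m = n := by
      have h : n - (m + 1) + 1 + m = n := by omega
      exact_mod_cast h
    unfold g
    rw [sub_mul, coeff_add, coeff_sub, coeff_C_mul, coeff_C_mul, coeff_derivative, hPm, hPm1]
    have hX : (X * derivative (P n (m + 1) a)).coeff m = (m : ℂ) := by
      cases m with
      | zero => simp
      | succ j =>
        rw [coeff_X_mul, coeff_derivative, hPm]
        push_cast
        ring
    rw [hX]
    linear_combination hnc
  have hn0 : (n : ℂ) ≠ 0 := by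
    have : n ≠ 0 := by omega
    exact_mod_cast this
  have hdeg : (g n (m + 1) a).natDegree = m :=
    natDegree_eq_of_le_of_coeff_ne_zero hgdeg (by rw [hgm]; exact hn0)
  refine ⟨?_, by simpa using hdeg, ?_, ?_, ?_⟩
  · unfold f g
    rw [derivative_mul, derivative_X_sub_C_pow]
    simp only [Nat.add_sub_cancel]
    ring
  · rw [leadingCoeff, hdeg, hgm]
  · have hPa : (P n (m + 1) a).eval a =
        ((∑ k ∈ Finset.range (m + 1), Nat.choose (n - (m + 1) + k) k : ℕ) : ℂ) * a ^ m := by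
      unfold P
      rw [eval_finset_sum, Nat.cast_sum, Finset.sum_mul]
      refine Finset.sum_congr rfl fun k hk => ?_
      have hk := Finset.mem_range.mp hk
      rw [eval_mul, eval_C, eval_pow, eval_X, mul_assoc, ← pow_add]
      congr 2
      omega
    have hpos : (∑ k ∈ Finset.range (m + 1), Nat.choose (n - (m + 1) + k) k) ≠ 0 := by
      refine (Finset.sum_pos (fun k _ => Nat.choose_pos (by omega)) ⟨0, by simp⟩).ne'
    unfold g
    simp only [eval_add, eval_mul, eval_C, eval_sub, eval_X, sub_self, zero_mul, add_zero, hPa]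
    exact mul_ne_zero (Nat.cast_ne_zero.mpr (by omega))
      (mul_ne_zero (Nat.cast_ne_zero.mpr hpos) (pow_ne_zero _ ha))
  · rw [← (IsAlgClosed.splits (g n (m + 1) a)).natDegree_eq_card_roots, hdeg]
    simp
end

section
/- Fix an integer ℓ ≥ 1, an integer k with 0 ≤ k ≤ ℓ - 1, and a nonzero complex number a. For each integer n ≥ ℓ, let g_{n,ℓ}(z) = f_{n,ℓ}'(z)/(z - a)^{n-ℓ} = (n-ℓ+1)·P_{n,ℓ}(z) + (z - a)·P_{n,ℓ}'(z). Then the coefficient of z^k in the polynomial ((n-ℓ)!·(ℓ-1)!/n!)·g_{n,ℓ}(a·n·z) converges, as n → ∞, to a^{ℓ-1}·(ℓ-1)!/(ℓ-1-k)!, i.e., to a^{ℓ-1} times the coefficient of z^k in Q_ℓ. -/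
open Polynomial Filter

lemma P_coeff (m k r : ℕ) (a : ℂ) :
    (P (m + (k + 1 + r)) (k + 1 + r) a).coeff k = ((m + r).choose r : ℂ) * a ^ r := by
  unfold P
  rw [finsetSum_coeff, Finset.sum_eq_single r]
  · rw [coeff_C_mul_X_pow, if_pos (by omega), Nat.add_sub_cancel]
  · intro b hb hbr
    rw [Finset.mem_range] at hb
    rw [coeff_C_mul_X_pow, if_neg (by omega)]
  · intro h
    exact absurd (Finset.mem_range.2 (by omega)) h

lemma P_coeff_top (n k : ℕ) (a : ℂ) :
    (P n (k + 1) a).coeff (k + 1) = 0 := by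
  unfold P
  rw [finsetSum_coeff]
  refine Finset.sum_eq_zero fun b hb => ?_
  rw [coeff_C_mul_X_pow, if_neg (by omega)]

lemma g_coeff (M k r : ℕ) (a : ℂ) :
    (g (M + 1 + (k + 1 + r)) (k + 1 + r) a).coeff k
      = ((M + 1 + (k + 1 + r) : ℕ) : ℂ) * ((M + r).choose r : ℂ) * a ^ r := by
  have h1 : (g (M + 1 + (k + 1 + r)) (k + 1 + r) a).coeff k
      = ((M + 2 + k : ℕ) : ℂ) * (P (M + 1 + (k + 1 + r)) (k + 1 + r) a).coeff k
        - a * ((k + 1) * (P (M + 1 + (k + 1 + r)) (k + 1 + r) a).coeff (k + 1)) := by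
    unfold g
    rw [coeff_add, coeff_C_mul, sub_mul, coeff_sub, coeff_C_mul, coeff_derivative,
      Nat.add_sub_cancel]
    cases k with
    | zero => simp; ring
    | succ k => rw [coeff_X_mul, coeff_derivative]; push_cast; ring
  rw [h1, P_coeff]
  cases r with
  | zero => 
    rw [Nat.add_zero, P_coeff_top]; simp; ring
  | succ r =>
    have h2 : k + 1 + (r + 1) = (k + 1) + 1 + r := by ring
    have h3 := P_coeff (M + 1) (k + 1) r a
    rw [← h2] at h3
    rw [h3]
    have e1 : ((M + 1 + (r + 1)).choose (r + 1) : ℂ)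
        = (M + 1 + r).choose r + (M + 1 + r).choose (r + 1) := by
      exact_mod_cast Nat.choose_succ_succ (M + 1 + r) r
    have e2 : ((M + 1 + r).choose (r + 1) : ℂ) * (r + 1) = (M + 1 + r).choose r * (M + 1) := by
      have := Nat.choose_succ_right_eq (M + 1 + r) r
      rw [Nat.add_sub_cancel] at this
      exact_mod_cast this
    have e3 : M + (r + 1) = M + 1 + r := by ring
    rw [e1, e3]
    push_cast
    linear_combination (-a ^ (r + 1)) * e2

lemma asc_lim (c s : ℕ) :
    Tendsto (fun m : ℕ => ((m + c).ascFactorial s : ℂ) / (m : ℂ) ^ s) atTop (nhds 1) := by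
  induction s with
  | zero => simp
  | succ s ih =>
    have h : Tendsto (fun m : ℕ => 1 + ((c + s : ℕ) : ℂ) / (m : ℂ)) atTop (nhds (1 + 0)) :=
      tendsto_const_nhds.add (tendsto_const_div_atTop_nhds_zero_nat _)
    have h2 := h.mul ih
    rw [add_zero, one_mul] at h2
    refine h2.congr' ?_
    filter_upwards [eventually_ge_atTop 1] with m hm
    have : (m : ℂ) ≠ 0 := by exact_mod_cast (by omega : m ≠ 0)
    rw [Nat.ascFactorial_succ]
    push_cast
    field_simp
    ring

lemma pow_lim (c s : ℕ) :
    Tendsto (fun m : ℕ => ((m + c : ℕ) : ℂ) ^ s / (m : ℂ) ^ s) atTop (nhds 1) := by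
  have h := (asc_lim c 1).pow s
  rw [one_pow] at h
  refine h.congr fun m => ?_
  simp [div_pow, Nat.ascFactorial_succ]

/-- For fixed `ℓ ≥ 1`, `0 ≤ k ≤ ℓ - 1` and `a ≠ 0`, the coefficient of `z^k` in
`((n-ℓ)!·(ℓ-1)!/n!)·g_{n,ℓ}(a·n·z)` converges, as `n → ∞`, to
`a^{ℓ-1}·(ℓ-1)!/(ℓ-1-k)!`. -/
theorem g_rescaled_coeff_limit (ℓ k : ℕ) (hℓ : 1 ≤ ℓ) (hk : k ≤ ℓ - 1) (a : ℂ) (ha : a ≠ 0) :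
    Tendsto
      (fun n : ℕ =>
        (C ((((n - ℓ).factorial : ℂ) * ((ℓ - 1).factorial : ℂ)) / (n.factorial : ℂ)) *
            (g n ℓ a).comp (C (a * (n : ℂ)) * X)).coeff k)
      atTop
      (nhds (a ^ (ℓ - 1) * (((ℓ - 1).factorial : ℂ) / ((ℓ - 1 - k).factorial : ℂ)))) := by
  obtain ⟨r, rfl⟩ : ∃ r, ℓ = k + 1 + r := ⟨ℓ - (k + 1), by omega⟩
  have hs1 : k + 1 + r - 1 = k + r := by omega
  rw [hs1, Nat.add_sub_cancel_left]
  rw [← tendsto_add_atTop_iff_nat (k + 1 + r)]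
  have hl := (((pow_lim (k + 1 + r) (k + 1)).mul (asc_lim 0 r)).div
    (asc_lim 1 (k + 1 + r)) one_ne_zero).const_mul
      (a ^ (k + r) * (((k + r).factorial : ℂ) / (r.factorial : ℂ)))
  rw [one_mul, div_one, mul_one] at hl
  refine hl.congr' ?_
  filter_upwards [eventually_ge_atTop 1] with m hm
  obtain ⟨M, rfl⟩ : ∃ M, m = M + 1 := ⟨m - 1, by omega⟩
  rw [coeff_C_mul, comp_C_mul_X_coeff, g_coeff, Nat.add_sub_cancel]
  have hf := Nat.factorial_mul_ascFactorial (M + 1) (k + 1 + r)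
  have hc := Nat.ascFactorial_eq_factorial_mul_choose M r
  have hm0 : ((M + 1 : ℕ) : ℂ) ≠ 0 := by exact_mod_cast Nat.succ_ne_zero M
  have hr0 : (r.factorial : ℂ) ≠ 0 := by exact_mod_cast r.factorial_ne_zero
  have hM0 : ((M + 1).factorial : ℂ) ≠ 0 := by exact_mod_cast (M + 1).factorial_ne_zero
  have hA0 : ((M + 1 + 1).ascFactorial (k + 1 + r) : ℂ) ≠ 0 := by
    exact_mod_cast (Nat.ascFactorial_pos _ _).ne'
  simp only [Pi.div_apply]
  rw [← hf, Nat.add_zero, hc]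
  generalize hN : ((M + 1 + (k + 1 + r) : ℕ) : ℂ) = N
  rw [Nat.cast_mul, Nat.cast_mul]
  generalize ((M + 1 : ℕ) : ℂ) = x at *
  field_simp
  ring
end

section
/- For every odd integer ℓ ≥ 1, the polynomial Q_ℓ has no real zeros: for every real number x, ∑_{k=0}^{ℓ-1} ((ℓ-1)!/(ℓ-1-k)!)·x^k ≠ 0. -/
theorem trunc_hasDerivAt (n : ℕ) (y : ℝ) :
    HasDerivAt (fun y : ℝ => ∑ j ∈ Finset.range (n + 1), y ^ j / (j.factorial : ℝ))
      (∑ j ∈ Finset.range n, y ^ j / (j.factorial : ℝ)) y := by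
  induction n with
  | zero => simpa using hasDerivAt_const y (1 : ℝ)
  | succ n ih =>
    have h := ih.add ((hasDerivAt_pow (n + 1) y).div_const ((n + 1).factorial : ℝ))
    have hf : (fun y : ℝ => ∑ j ∈ Finset.range (n + 1 + 1), y ^ j / (j.factorial : ℝ)) =
        (fun y : ℝ => ∑ j ∈ Finset.range (n + 1), y ^ j / (j.factorial : ℝ)) +
          fun y : ℝ => y ^ (n + 1) / ((n + 1).factorial : ℝ) := by
      funext z
      simp [Finset.sum_range_succ _ (n + 1)]
    rw [hf]
    refine h.congr_deriv ?_
    rw [Finset.sum_range_succ]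
    congr 1
    rw [Nat.factorial_succ]
    have : (n.factorial : ℝ) ≠ 0 := by positivity
    have h2 : (n : ℝ) + 1 ≠ 0 := by positivity
    push_cast
    field_simp

theorem trunc_pos (n : ℕ) (hn : Even n) (y : ℝ) :
    0 < ∑ j ∈ Finset.range (n + 1), y ^ j / (j.factorial : ℝ) := by
  rcases le_total 0 y with hy | hy
  · rw [Finset.sum_range_succ']
    have : 0 ≤ ∑ j ∈ Finset.range n, y ^ (j + 1) / ((j + 1).factorial : ℝ) :=
      Finset.sum_nonneg fun j _ => by positivity
    simp only [pow_zero, Nat.factorial_zero, Nat.cast_one, div_one]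
    linarith
  · have hd : ∀ z : ℝ, HasDerivAt
        (fun z : ℝ => Real.exp (-z) * ∑ j ∈ Finset.range (n + 1), z ^ j / (j.factorial : ℝ))
        (-(Real.exp (-z) * (z ^ n / (n.factorial : ℝ)))) z := by
      intro z
      have h := ((hasDerivAt_neg z).exp).mul (trunc_hasDerivAt n z)
      refine h.congr_deriv ?_
      rw [Finset.sum_range_succ]
      ring
    have ha := antitone_of_hasDerivAt_nonpos hd (fun z => by
      have := hn.pow_nonneg z
      have : 0 ≤ Real.exp (-z) * (z ^ n / (n.factorial : ℝ)) := by positivity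
      simpa using this)
    have h1 := ha hy
    have h0 : ∑ j ∈ Finset.range (n + 1), (0 : ℝ) ^ j / (j.factorial : ℝ) = 1 := by
      rw [Finset.sum_range_succ']
      simp
    simp only [h0, neg_zero, Real.exp_zero, mul_one] at h1
    exact pos_of_mul_pos_right (lt_of_lt_of_le one_pos h1) (Real.exp_pos _).le

/-- For every odd `ℓ ≥ 1`, the polynomial `Q_ℓ(x) = ∑_{k=0}^{ℓ-1} ((ℓ-1)!/(ℓ-1-k)!)·x^k`
has no real zeros. -/
theorem Q_no_real_zeros (ℓ : ℕ) (hℓ : 1 ≤ ℓ) (hodd : Odd ℓ) (x : ℝ) :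
    ∑ k ∈ Finset.range ℓ, (((ℓ - 1).factorial : ℝ) / ((ℓ - 1 - k).factorial : ℝ)) * x ^ k ≠ 0 := by
  obtain ⟨n, rfl⟩ : ∃ n, ℓ = n + 1 := ⟨ℓ - 1, by omega⟩
  have hn : Even n := by
    rcases Nat.even_or_odd n with h | h
    · exact h
    · exact absurd hodd (by simpa using h.add_one)
  simp only [Nat.add_sub_cancel]
  by_cases hx : x = 0
  · subst hx
    rw [Finset.sum_range_succ']
    have : (n.factorial : ℝ) ≠ 0 := by positivity
    simp [this]
  · have key : ∑ k ∈ Finset.range (n + 1), ((n.factorial : ℝ) / ((n - k).factorial : ℝ)) * x ^ k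
        = (n.factorial : ℝ) * x ^ n *
          ∑ j ∈ Finset.range (n + 1), (x⁻¹) ^ j / (j.factorial : ℝ) := by
      rw [← Finset.sum_range_reflect, Finset.mul_sum]
      refine Finset.sum_congr rfl fun j hj => ?_
      have hj' : j ≤ n := by
        have := Finset.mem_range.1 hj
        omega
      have e1 : n + 1 - 1 - j = n - j := by omega
      have e2 : n - (n - j) = j := by omega
      have e3 : x ^ n = x ^ (n - j) * x ^ j := by rw [← pow_add]; congr 1; omega
      rw [e1, e2, e3, inv_pow]
      have : x ^ j ≠ 0 := pow_ne_zero _ hx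
      field_simp
    rw [key]
    have : (n.factorial : ℝ) ≠ 0 := by positivity
    exact mul_ne_zero (mul_ne_zero this (pow_ne_zero _ hx)) (trunc_pos n hn _).ne'
end

section
/- Fix an integer ℓ ≥ 1 and a nonzero real number a, and let K ⊂ ℂ be a compact set on which Q_ℓ does not vanish. Then there exists N such that for all integers n ≥ N and all z ∈ K one has P_{n,ℓ}(a·n·z) ≠ 0. (The zeros of z ↦ P_{n,ℓ}(a·n·z) converge to the zeros of Q_ℓ.) -/
open Polynomial

/-- `Q ℓ` is the polynomial `Q_ℓ(z) = ∑_{k=0}^{ℓ-1} ((ℓ-1)!/(ℓ-1-k)!)·z^k`. -/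
noncomputable def Q (ℓ : ℕ) : Polynomial ℂ :=
  ∑ k ∈ Finset.range ℓ, C (((ℓ - 1).factorial : ℂ) / ((ℓ - 1 - k).factorial : ℂ)) * X ^ k

open Filter Topology in
lemma choose_ratio_tendsto (ℓ k : ℕ) :
    Tendsto (fun n : ℕ => (Nat.choose (n - ℓ + k) k : ℂ) / (n : ℂ) ^ k) atTop
      (𝓝 (1 / (k.factorial : ℂ))) := by
  have hfac : ∀ i : ℕ, Tendsto (fun n : ℕ => ((n - ℓ + 1 + i : ℕ) : ℂ) / (n : ℂ)) atTop (𝓝 1) := by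
    intro i
    have h1 : Tendsto (fun n : ℕ => 1 + ((1 + i : ℂ) - ℓ) / (n : ℂ)) atTop (𝓝 (1 + 0)) :=
      tendsto_const_nhds.add (tendsto_const_div_atTop_nhds_zero_nat _)
    rw [add_zero] at h1
    refine h1.congr' ?_
    filter_upwards [eventually_ge_atTop (ℓ + 1)] with n hn
    have hn0 : (n : ℂ) ≠ 0 := by
      have : n ≠ 0 := by omega
      exact_mod_cast this
    push_cast [Nat.cast_sub (show ℓ ≤ n by omega)]
    field_simp
    ring
  have hprod := tendsto_finsetProd (Finset.range k) (fun i _ => hfac i)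
  have h2 := hprod.div_const (k.factorial : ℂ)
  simp only [Finset.prod_const_one] at h2
  refine h2.congr ?_
  intro n
  have h3 : (n - ℓ + 1).ascFactorial k = k.factorial * (n - ℓ + k).choose k :=
    Nat.ascFactorial_eq_factorial_mul_choose _ _
  rw [Nat.ascFactorial_eq_prod_range] at h3
  have h4 : (∏ i ∈ Finset.range k, ((n - ℓ + 1 + i : ℕ) : ℂ)) =
      (k.factorial : ℂ) * ((n - ℓ + k).choose k : ℂ) := by exact_mod_cast h3
  have hk : (k.factorial : ℂ) ≠ 0 := by exact_mod_cast k.factorial_ne_zero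
  rw [Finset.prod_div_distrib, h4, Finset.prod_const, Finset.card_range]
  field_simp

open Filter Topology in
theorem zeros_P_rescaled_avoid (ℓ : ℕ) (hℓ : 1 ≤ ℓ) (a : ℝ) (ha : a ≠ 0)
    (K : Set ℂ) (hK : IsCompact K) (hQ : ∀ z ∈ K, (Q ℓ).eval z ≠ 0) :
    ∃ N : ℕ, ∀ n : ℕ, N ≤ n → ∀ z ∈ K, (P n ℓ (a : ℂ)).eval ((a : ℂ) * (n : ℂ) * z) ≠ 0 := by
  have ha' : (a : ℂ) ≠ 0 := by exact_mod_cast ha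
  let F : (ℕ → ℂ) → ℂ → ℂ := fun c z => ∑ k ∈ Finset.range ℓ, c k * z ^ (ℓ - 1 - k)
  have hF : Continuous (fun p : (ℕ → ℂ) × ℂ => F p.1 p.2) := by
    simp only [F]
    fun_prop
  let c₀ : ℕ → ℂ := fun k => 1 / (k.factorial : ℂ)
  have hQF : ∀ z, (Q ℓ).eval z = ((ℓ - 1).factorial : ℂ) * F c₀ z := by
    intro z
    simp only [Q, F, c₀, eval_finsetSum, eval_mul, eval_C, eval_pow, eval_X]
    rw [← Finset.sum_range_reflect, Finset.mul_sum]
    refine Finset.sum_congr rfl fun k hk => ?_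
    have hk' := Finset.mem_range.mp hk
    rw [show ℓ - 1 - (ℓ - 1 - k) = k by omega]
    ring
  have hev : ∀ᶠ c in 𝓝 c₀, ∀ z ∈ K, F c z ≠ 0 := by
    refine hK.eventually_forall_of_forall_eventually fun z hz => ?_
    have h0 : F c₀ z ≠ 0 := fun h => hQ z hz (by rw [hQF, h, mul_zero])
    exact hF.continuousAt.eventually_ne (x := (c₀, z)) h0
  have hlim : Tendsto (fun (n : ℕ) (k : ℕ) => (Nat.choose (n - ℓ + k) k : ℂ) / (n : ℂ) ^ k) atTop
      (𝓝 c₀) := tendsto_pi_nhds.mpr fun k => choose_ratio_tendsto ℓ k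
  obtain ⟨N, hN⟩ := eventually_atTop.mp (hlim.eventually hev)
  refine ⟨N + 1, fun n hn z hz h => hN n (by omega) z hz ?_⟩
  have hn0 : (n : ℂ) ≠ 0 := by
    have : n ≠ 0 := by omega
    exact_mod_cast this
  have key : (P n ℓ (a : ℂ)).eval ((a : ℂ) * (n : ℂ) * z) = ((a : ℂ) * n) ^ (ℓ - 1) *
      F (fun k => (Nat.choose (n - ℓ + k) k : ℂ) / (n : ℂ) ^ k) z := by
    simp only [P, F, eval_finsetSum, eval_mul, eval_C, eval_pow, eval_X]
    rw [Finset.mul_sum]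
    refine Finset.sum_congr rfl fun k hk => ?_
    have hk' := Finset.mem_range.mp hk
    obtain ⟨m, hm⟩ : ∃ m, ℓ - 1 = k + m := ⟨ℓ - 1 - k, by omega⟩
    rw [hm, show k + m - k = m by omega]
    field_simp
    ring
  rw [key] at h
  exact (mul_eq_zero.mp h).resolve_left (pow_ne_zero _ (mul_ne_zero ha' hn0))
end

section
/- Fix an odd integer ℓ ≥ 1 and a nonzero real number a. There exist ε > 0 (independent of n) and an integer N > ℓ such that for every integer n ≥ N the following holds: every complex zero z of P_{n,ℓ} and every complex zero z ≠ a of the derivative f_{n,ℓ}' satisfies |arg(z - a)| ≤ π - ε, where arg denotes the principal argument with values in (-π, π]. In other words, the open sector centered at a containing the direction of the negative real axis with half-angle ε contains no zeros of P_{n,ℓ} and no critical points of f_{n,ℓ} other than a. -/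
open Polynomial Real

lemma trunc_exp_pos (d : ℕ) (hd : Even d) (x : ℝ) :
    0 < ∑ k ∈ Finset.range (d + 1), x ^ k / (k.factorial : ℝ) := by
  rcases le_total 0 x with hx | hx
  · rw [Finset.sum_range_succ']
    have : 0 ≤ ∑ k ∈ Finset.range d, x ^ (k + 1) / ((k + 1).factorial : ℝ) :=
      Finset.sum_nonneg fun k _ => by positivity
    simp
    linarith
  · have hder : ∀ (e : ℕ) (y : ℝ),
        HasDerivAt (fun y : ℝ => ∑ k ∈ Finset.range (e + 1), y ^ k / (k.factorial : ℝ))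
          (∑ k ∈ Finset.range e, y ^ k / (k.factorial : ℝ)) y := by
      intro e y
      induction e with
      | zero => simpa using hasDerivAt_const y (1 : ℝ)
      | succ e ih =>
        have h1 : HasDerivAt (fun y : ℝ => y ^ (e + 1) / ((e + 1).factorial : ℝ))
            (y ^ e / (e.factorial : ℝ)) y := by
          have := (hasDerivAt_pow (e + 1) y).div_const ((e + 1).factorial : ℝ)
          refine this.congr_deriv ?_
          rw [Nat.factorial_succ]
          push_cast
          have : (e.factorial : ℝ) ≠ 0 := by positivity
          have : (e : ℝ) + 1 ≠ 0 := by positivity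
          field_simp
        have h2 := ih.add h1
        rw [← Finset.sum_range_succ (fun k => y ^ k / (k.factorial : ℝ)) e] at h2
        have h3 : (fun y : ℝ => ∑ k ∈ Finset.range (e + 1 + 1), y ^ k / (k.factorial : ℝ)) =
            (fun y : ℝ => ∑ k ∈ Finset.range (e + 1), y ^ k / (k.factorial : ℝ)) +
              fun y : ℝ => y ^ (e + 1) / ((e + 1).factorial : ℝ) := by
          funext y
          simp [Finset.sum_range_succ _ (e + 1)]
        rw [h3]
        exact h2
    have hg : ∀ y : ℝ, HasDerivAt (fun y : ℝ => Real.exp (-y) *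
        ∑ k ∈ Finset.range (d + 1), y ^ k / (k.factorial : ℝ))
        (-(Real.exp (-y) * (y ^ d / (d.factorial : ℝ)))) y := by
      intro y
      have h1 : HasDerivAt (fun y : ℝ => Real.exp (-y)) (Real.exp (-y) * (-1)) y :=
        (hasDerivAt_neg y).exp
      refine (h1.mul (hder d y)).congr_deriv ?_
      rw [Finset.sum_range_succ]
      ring
    have hanti := antitone_of_hasDerivAt_nonpos hg (fun y => by
      have : 0 ≤ y ^ d := hd.pow_nonneg y
      have h4 : 0 ≤ Real.exp (-y) * (y ^ d / (d.factorial : ℝ)) := by positivity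
      exact neg_nonpos.2 h4)
    have h := hanti hx
    simp only [neg_zero, Real.exp_zero, one_mul] at h
    rw [Finset.sum_range_succ'] at h
    simp at h
    have h3 := Real.exp_pos (-x)
    by_contra hc
    push Not at hc
    nlinarith

lemma tendsto_b (k : ℕ) : Filter.Tendsto
    (fun j : ℕ => (Nat.choose (j + k) k : ℂ) / ((j : ℂ) + 1) ^ k) Filter.atTop
    (nhds (1 / (k.factorial : ℂ))) := by
  induction k with
  | zero => simp
  | succ k ih =>
    have h0 := tendsto_one_div_add_atTop_nhds_zero_nat (𝕜 := ℂ)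
    have h1 : Filter.Tendsto (fun j : ℕ => (Nat.choose (j + k) k : ℂ) / ((j : ℂ) + 1) ^ k *
        ((1 + k * (1 / ((j : ℂ) + 1))) / (k + 1))) Filter.atTop
        (nhds (1 / (k.factorial : ℂ) * ((1 + k * 0) / (k + 1)))) :=
      ih.mul (((h0.const_mul (k : ℂ)).const_add 1).div_const _)
    have hk : (k : ℂ) + 1 ≠ 0 := by exact_mod_cast Nat.succ_ne_zero k
    have hkf : (k.factorial : ℂ) ≠ 0 := by exact_mod_cast Nat.factorial_ne_zero k
    convert h1 using 1
    · funext j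
      have hj : (j : ℂ) + 1 ≠ 0 := by exact_mod_cast Nat.succ_ne_zero j
      have h := Nat.add_one_mul_choose_eq (j + k) k
      have h' : ((j : ℂ) + k + 1) * (Nat.choose (j + k) k : ℂ)
          = (Nat.choose (j + (k + 1)) (k + 1) : ℂ) * (k + 1) := by exact_mod_cast h
      field_simp
      linear_combination (-((j : ℂ) + 1) ^ (k + 1)) * h'
    · rw [Nat.factorial_succ]
      push_cast
      congr 1
      field_simp
      ring

/-- Homogenized, rescaled form of `P` (`κ = 0`) and of the reduced derivative (`κ = η`). -/
noncomputable def G (d : ℕ) (a : ℂ) (b : ℕ → ℂ) (η κ u : ℂ) (s : ℝ) : ℂ :=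
  ∑ k ∈ Finset.range (d + 1), b k * a ^ k * (1 - s : ℂ) ^ k *
    ((u * s + a * η * (1 - s)) ^ (d - k) +
      κ * (d - k : ℕ) * (u * s) * (u * s + a * η * (1 - s)) ^ (d - k - 1))

lemma G_limit_ne (d : ℕ) (hd : Even d) (a : ℝ) (ha : a ≠ 0) (s : ℝ) (hs : s ∈ Set.Icc (0 : ℝ) 1) :
    G d a (fun k => 1 / (k.factorial : ℂ)) 0 0 (-1) s ≠ 0 := by
  have key : G d a (fun k => 1 / (k.factorial : ℂ)) 0 0 (-1) s =
      ((∑ k ∈ Finset.range (d + 1), (a * (1 - s)) ^ k / (k.factorial : ℝ) * (-s) ^ (d - k) : ℝ) : ℂ) := by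
    unfold G
    push_cast
    refine Finset.sum_congr rfl fun k _ => ?_
    simp only [mul_zero, zero_mul, add_zero, neg_mul, one_mul, mul_pow]
    ring
  rw [key, Complex.ofReal_ne_zero]
  rcases eq_or_ne s 0 with rfl | h0
  · rw [Finset.sum_range_succ, Finset.sum_eq_zero]
    · have : (d.factorial : ℝ) ≠ 0 := by positivity
      simp [ha, this]
    · intro k hk
      have : d - k ≠ 0 := by have := Finset.mem_range.1 hk; omega
      simp [this]
  · have h1 : ∑ k ∈ Finset.range (d + 1), (a * (1 - s)) ^ k / (k.factorial : ℝ) * (-s) ^ (d - k)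
        = (-s) ^ d * ∑ k ∈ Finset.range (d + 1), (a * (1 - s) / (-s)) ^ k / (k.factorial : ℝ) := by
      rw [Finset.mul_sum]
      refine Finset.sum_congr rfl fun k hk => ?_
      have hk' : k ≤ d := by have := Finset.mem_range.1 hk; omega
      have hs0 : -s ≠ 0 := neg_ne_zero.2 h0
      have : (-s) ^ d = (-s) ^ (d - k) * (-s) ^ k := by rw [← pow_add]; congr 1; omega
      rw [this, div_pow]
      field_simp
    rw [h1]
    exact mul_ne_zero (pow_ne_zero _ (neg_ne_zero.2 h0)) (trunc_exp_pos d hd _).ne'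

lemma G_eventually (d : ℕ) (hd : Even d) (a : ℝ) (ha : a ≠ 0) :
    ∀ᶠ q : ((ℕ → ℂ) × ℂ × ℂ) × ℂ in
      nhds (((fun k => 1 / (k.factorial : ℂ)), 0, 0), (-1 : ℂ)),
      ∀ s ∈ Set.Icc (0 : ℝ) 1, G d a q.1.1 q.1.2.1 q.1.2.2 q.2 s ≠ 0 := by
  refine isCompact_Icc.eventually_forall_of_forall_eventually fun s hs => ?_
  have hc : Continuous fun p : (((ℕ → ℂ) × ℂ × ℂ) × ℂ) × ℝ =>
      G d a p.1.1.1 p.1.1.2.1 p.1.1.2.2 p.1.2 p.2 := by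
    unfold G
    fun_prop
  exact hc.continuousAt.eventually_ne (G_limit_ne d hd a ha s hs)

/-- The scaling identity. -/
lemma G_eq (d j : ℕ) (a κ u : ℂ) (r : ℝ) (hr : 0 ≤ r) :
    G d a (fun k => (Nat.choose (j + k) k : ℂ) / ((j : ℂ) + 1) ^ k) (1 / ((j : ℂ) + 1)) κ u
      (r / (j + 1) / (1 + r / (j + 1))) =
    (1 / (1 + r / ((j : ℂ) + 1))) ^ d / ((j : ℂ) + 1) ^ d *
      ∑ k ∈ Finset.range (d + 1), (Nat.choose (j + k) k : ℂ) * a ^ k *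
        ((a + u * r) ^ (d - k) + κ * (d - k : ℕ) * (u * r) * (a + u * r) ^ (d - k - 1)) := by
  unfold G
  rw [Finset.mul_sum]
  refine Finset.sum_congr rfl fun k hk => ?_
  have hk' : k ≤ d := by have := Finset.mem_range.1 hk; omega
  have hj : (j : ℂ) + 1 ≠ 0 := by exact_mod_cast Nat.succ_ne_zero j
  have hρ : (1 + r / ((j : ℂ) + 1)) ≠ 0 := by
    have : (1 + r / ((j : ℝ) + 1)) ≠ 0 := by positivity
    exact_mod_cast this
  push_cast
  set m : ℂ := (j : ℂ) + 1
  set y : ℂ := 1 / (1 + r / m) with hy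
  have hs : (r : ℂ) / m / (1 + r / m) = r / m * y := by rw [hy]; ring
  have h1 : (1 : ℂ) - r / m * y = y := by
    have : (1 + r / m) * y = 1 := by rw [hy]; exact mul_one_div_cancel hρ
    linear_combination -this
  rw [hs, h1]
  have h2 : u * (r / m * y) + a * (1 / m) * y = (y / m) * (a + u * r) := by ring
  rw [h2]
  rcases Nat.lt_or_ge k d with h | h
  · obtain ⟨e, rfl⟩ : ∃ e, d = k + (e + 1) := ⟨d - k - 1, by omega⟩
    have e1 : k + (e + 1) - k = e + 1 := by omega
    rw [e1]
    simp only [Nat.add_sub_cancel, mul_pow, div_pow]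
    field_simp
    ring
  · obtain rfl : k = d := le_antisymm hk' h
    simp
    field_simp

lemma P_eval (d j : ℕ) (a z : ℂ) : (P (j + (d + 1)) (d + 1) a).eval z =
    ∑ k ∈ Finset.range (d + 1), (Nat.choose (j + k) k : ℂ) * a ^ k * z ^ (d - k) := by
  simp [P, eval_finsetSum]

lemma P_deriv_eval (d j : ℕ) (a z : ℂ) : (derivative (P (j + (d + 1)) (d + 1) a)).eval z =
    ∑ k ∈ Finset.range (d + 1), (Nat.choose (j + k) k : ℂ) * a ^ k *
      ((d - k : ℕ) * z ^ (d - k - 1)) := by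
  simp [P, eval_finsetSum, -map_mul, derivative_X_pow]

lemma f_deriv_eval (d j : ℕ) (a z : ℂ) : (derivative (f (j + (d + 1)) (d + 1) a)).eval z =
    (z - a) ^ j * (((j : ℂ) + 1) * (P (j + (d + 1)) (d + 1) a).eval z +
      (z - a) * (derivative (P (j + (d + 1)) (d + 1) a)).eval z) := by
  have : j + (d + 1) - (d + 1) + 1 = j + 1 := by omega
  simp only [f, this, derivative_mul, derivative_X_sub_C_pow]
  simp
  ring

/-- Fix an odd `ℓ ≥ 1` and a nonzero real `a`.  There exist `ε > 0` (independent of `n`)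
and an integer `N > ℓ` such that for all `n ≥ N`, every zero `z` of `P_{n,ℓ}` and every
critical point `z ≠ a` of `f_{n,ℓ}` satisfies `|arg(z - a)| ≤ π - ε`: the open sector at
`a` around the negative real direction of half-angle `ε` contains no such points. -/
theorem sector_free_of_zeros (ℓ : ℕ) (hℓ : 1 ≤ ℓ) (hodd : Odd ℓ) (a : ℝ) (ha : a ≠ 0) :
    ∃ ε : ℝ, 0 < ε ∧ ∃ N : ℕ, ℓ < N ∧ ∀ n : ℕ, N ≤ n →
      (∀ z : ℂ, (P n ℓ (a : ℂ)).eval z = 0 → |Complex.arg (z - (a : ℂ))| ≤ π - ε) ∧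
      (∀ z : ℂ, z ≠ (a : ℂ) → (derivative (f n ℓ (a : ℂ))).eval z = 0 →
        |Complex.arg (z - (a : ℂ))| ≤ π - ε) := by
  obtain ⟨d, rfl⟩ : ∃ d, ℓ = d + 1 := ⟨ℓ - 1, by omega⟩
  have hd : Even d := by
    rcases hodd with ⟨c, hc⟩
    exact ⟨c, by omega⟩
  have hG := G_eventually d hd a ha
  rw [nhds_prod_eq, Filter.eventually_prod_iff] at hG
  obtain ⟨pa, hpa, pb, hpb, hab⟩ := hG
  have hη := tendsto_one_div_add_atTop_nhds_zero_nat (𝕜 := ℂ)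
  have hb : Filter.Tendsto (fun (j : ℕ) (k : ℕ) => (Nat.choose (j + k) k : ℂ) / ((j : ℂ) + 1) ^ k)
      Filter.atTop (nhds (fun k => 1 / (k.factorial : ℂ))) :=
    tendsto_pi_nhds.2 tendsto_b
  have hE1 := (hb.prodMk_nhds (hη.prodMk_nhds
    (tendsto_const_nhds (x := (0 : ℂ))))).eventually hpa
  have hE2 := (hb.prodMk_nhds (hη.prodMk_nhds hη)).eventually hpa
  obtain ⟨J, hJ⟩ := Filter.eventually_atTop.1 (hE1.and hE2)
  have hcont : Continuous fun θ : ℝ => Complex.exp (θ * Complex.I) := by fun_prop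
  have hθ1 : ∀ᶠ θ : ℝ in nhds π, pb (Complex.exp (θ * Complex.I)) := by
    refine hcont.continuousAt.eventually ?_
    dsimp only
    rw [Complex.exp_pi_mul_I]
    exact hpb
  have hθ2 : ∀ᶠ θ : ℝ in nhds (-π), pb (Complex.exp (θ * Complex.I)) := by
    refine hcont.continuousAt.eventually ?_
    have : Complex.exp (((-π : ℝ) : ℂ) * Complex.I) = -1 := by
      push_cast
      rw [neg_mul, Complex.exp_neg, Complex.exp_pi_mul_I]
      norm_num
    dsimp only
    rw [this]
    exact hpb
  obtain ⟨ε₁, hε₁, h₁⟩ := Metric.eventually_nhds_iff.1 hθ1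
  obtain ⟨ε₂, hε₂, h₂⟩ := Metric.eventually_nhds_iff.1 hθ2
  refine ⟨min ε₁ ε₂, lt_min hε₁ hε₂, d + 1 + 1 + J, by omega, fun n hn => ?_⟩
  obtain ⟨j, rfl⟩ : ∃ j, n = j + (d + 1) := ⟨n - (d + 1), by omega⟩
  obtain ⟨hj1, hj2⟩ := hJ j (by omega)
  have hmne : (j : ℂ) + 1 ≠ 0 := by exact_mod_cast Nat.succ_ne_zero j
  have hsec : ∀ t : ℂ, ¬ |Complex.arg t| ≤ π - min ε₁ ε₂ →
      pb (Complex.exp (Complex.arg t * Complex.I)) := by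
    intro t ht
    push Not at ht
    have hl := Complex.neg_pi_lt_arg t
    have hu := Complex.arg_le_pi t
    have hm1 := min_le_left ε₁ ε₂
    have hm2 := min_le_right ε₁ ε₂
    rcases lt_abs.1 ht with h | h
    · refine h₁ ?_
      rw [Real.dist_eq, abs_lt]
      constructor <;> linarith
    · refine h₂ ?_
      rw [Real.dist_eq, abs_lt]
      constructor <;> linarith
  have hmain : ∀ (z κ : ℂ), pa ((fun k => (Nat.choose (j + k) k : ℂ) / ((j : ℂ) + 1) ^ k),
      1 / ((j : ℂ) + 1), κ) → ¬ |Complex.arg (z - a)| ≤ π - min ε₁ ε₂ →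
      ∑ k ∈ Finset.range (d + 1), (Nat.choose (j + k) k : ℂ) * (a : ℂ) ^ k *
        (z ^ (d - k) + κ * (d - k : ℕ) * (z - a) * z ^ (d - k - 1)) ≠ 0 := by
    intro z κ hκ hz hsum
    have hr : 0 ≤ ‖z - a‖ := norm_nonneg _
    have hne := hab hκ (hsec _ hz) (‖z - a‖ / (j + 1) / (1 + ‖z - a‖ / (j + 1)))
      ⟨by positivity, by
        rw [div_le_one (by positivity)]
        linarith⟩
    refine hne ?_
    dsimp only
    rw [G_eq d j a κ _ _ hr]
    have ht : Complex.exp (Complex.arg (z - a) * Complex.I) * (‖z - a‖ : ℂ) = z - a := by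
      rw [mul_comm]
      exact Complex.norm_mul_exp_arg_mul_I _
    rw [ht, add_sub_cancel, hsum, mul_zero]
  constructor
  · intro z hz
    by_contra hc
    refine hmain z 0 hj1 hc ?_
    rw [P_eval] at hz
    simpa using hz
  · intro z hza hz
    by_contra hc
    refine hmain z _ hj2 hc ?_
    rw [f_deriv_eval] at hz
    have hz' := (mul_eq_zero.1 hz).resolve_left (pow_ne_zero _ (sub_ne_zero.2 hza))
    rw [P_eval, P_deriv_eval] at hz'
    have hfac : ((j : ℂ) + 1) * ∑ k ∈ Finset.range (d + 1), (Nat.choose (j + k) k : ℂ) *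
        (a : ℂ) ^ k * (z ^ (d - k) + 1 / ((j : ℂ) + 1) * (d - k : ℕ) * (z - a) * z ^ (d - k - 1))
        = 0 := by
      rw [← hz', Finset.mul_sum, Finset.mul_sum, Finset.mul_sum, ← Finset.sum_add_distrib]
      refine Finset.sum_congr rfl fun k _ => ?_
      field_simp
    exact (mul_eq_zero.1 hfac).resolve_left hmne
end

section
/- Fix an odd integer ℓ ≥ 1. There exists a real number c with 0 < c < 1 and an integer N such that for every even integer n ≥ N there is a nonzero complex number a for which the following holds: with p(z) = z^n + f_{n,ℓ}(z) and q(z) = z^n - f_{n,ℓ}(z) (so that q has degree m = n - ℓ), the zero set {z ∈ ℂ : p(z) + conj(q(z)) = 0} of the harmonic polynomial F = p + conj∘q is finite and its cardinality N_F satisfies N_F ≥ n² - 2·n·ℓ·(1 - c). -/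
open Polynomial

open Filter Topology in
lemma arg_atTop (ρ : ℂ) : Tendsto (fun t : ℝ => Complex.arg ((t : ℂ) - ρ)) atTop (𝓝 0) := by
  have h1 : Tendsto (fun t : ℝ => (1 : ℂ) - ((t⁻¹ : ℝ) : ℂ) * ρ) atTop (𝓝 1) := by
    have h0 : Tendsto (fun t : ℝ => ((t⁻¹ : ℝ) : ℂ)) atTop (𝓝 ((0 : ℝ) : ℂ)) :=
      (Complex.continuous_ofReal.tendsto 0).comp tendsto_inv_atTop_zero
    have := (tendsto_const_nhds (x := (1 : ℂ))).sub (h0.mul_const ρ)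
    simpa using this
  have h2 := (Complex.continuousAt_arg (x := 1) (by simp)).tendsto.comp h1
  rw [Complex.arg_one] at h2
  refine h2.congr' ?_
  filter_upwards [eventually_gt_atTop 0] with t ht
  have : (t : ℂ) - ρ = (t : ℂ) * ((1 : ℂ) - ((t⁻¹ : ℝ) : ℂ) * ρ) := by
    have : (t : ℂ) ≠ 0 := by exact_mod_cast ht.ne'
    push_cast; field_simp
  simp only [Function.comp]
  rw [this, Complex.arg_real_mul _ ht]

noncomputable def sg (ρ : ℂ) : ℤ := if ρ.im < 0 then 1 else -1

open Filter Topology in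
lemma arg_atBot (ρ : ℂ) (hρ : ρ.im ≠ 0) :
    Tendsto (fun t : ℝ => Complex.arg ((t : ℂ) - ρ)) atBot (𝓝 ((sg ρ : ℝ) * Real.pi)) := by
  have h1 : Tendsto (fun t : ℝ => (-1 : ℂ) + ((t⁻¹ : ℝ) : ℂ) * ρ) atBot (𝓝 (-1)) := by
    have h0 : Tendsto (fun t : ℝ => ((t⁻¹ : ℝ) : ℂ)) atBot (𝓝 ((0 : ℝ) : ℂ)) :=
      (Complex.continuous_ofReal.tendsto 0).comp tendsto_inv_atBot_zero
    have := (tendsto_const_nhds (x := (-1 : ℂ))).add (h0.mul_const ρ)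
    simpa using this
  have key : (fun t : ℝ => Complex.arg ((-1 : ℂ) + ((t⁻¹ : ℝ) : ℂ) * ρ)) =ᶠ[atBot]
      (fun t : ℝ => Complex.arg ((t : ℂ) - ρ)) := by
    filter_upwards [eventually_lt_atBot 0] with t ht
    have : (t : ℂ) - ρ = ((-t : ℝ) : ℂ) * ((-1 : ℂ) + ((t⁻¹ : ℝ) : ℂ) * ρ) := by
      have : (t : ℂ) ≠ 0 := by exact_mod_cast ht.ne
      push_cast; field_simp; ring
    rw [this, Complex.arg_real_mul _ (by linarith)]
  refine Tendsto.congr' key ?_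
  have him : ∀ t : ℝ, ((-1 : ℂ) + ((t⁻¹ : ℝ) : ℂ) * ρ).im = t⁻¹ * ρ.im := by
    intro t; simp only [Complex.add_im, Complex.im_ofReal_mul]; simp
  rcases lt_or_gt_of_ne hρ with h | h
  · have := Complex.tendsto_arg_nhdsWithin_im_nonneg_of_re_neg_of_im_zero
      (z := -1) (by simp) (by simp)
    simp only [sg, h, if_true, Int.cast_one, one_mul]
    refine this.comp (tendsto_nhdsWithin_iff.2 ⟨h1, ?_⟩)
    filter_upwards [eventually_lt_atBot 0] with t ht
    show 0 ≤ Complex.im _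
    rw [him]
    exact mul_nonneg_of_nonpos_of_nonpos (inv_nonpos.2 ht.le) h.le
  · have := Complex.tendsto_arg_nhdsWithin_im_neg_of_re_neg_of_im_zero
      (z := -1) (by simp) (by simp)
    simp only [sg, h.not_gt, if_false]
    rw [show (((-1 : ℤ) : ℝ) * Real.pi) = -Real.pi by push_cast; ring]
    refine this.comp (tendsto_nhdsWithin_iff.2 ⟨h1, ?_⟩)
    filter_upwards [eventually_lt_atBot 0] with t ht
    show Complex.im _ < 0
    rw [him]
    exact mul_neg_of_neg_of_pos (inv_lt_zero.2 ht) h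

noncomputable def Ph (R : Multiset ℂ) (t : ℝ) : ℝ :=
  (R.map (fun ρ => Complex.arg ((t : ℂ) - ρ))).sum

lemma Ph_cons (a : ℂ) (R : Multiset ℂ) (t : ℝ) :
    Ph (a ::ₘ R) t = Complex.arg ((t : ℂ) - a) + Ph R t := by simp [Ph]

open Filter Topology in
lemma Ph_props (R : Multiset ℂ) : (∀ ρ ∈ R, ρ.im ≠ 0) →
    Continuous (Ph R) ∧ Tendsto (Ph R) atTop (𝓝 0) ∧
    Tendsto (Ph R) atBot (𝓝 (((R.map sg).sum : ℤ) * Real.pi)) ∧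
    ∀ t : ℝ, ∃ r : ℝ, (R.map (fun ρ => (t : ℂ) - ρ)).prod =
      (r : ℂ) * Complex.exp (((Ph R t : ℝ) : ℂ) * Complex.I) := by
  induction R using Multiset.induction_on with
  | empty =>
    intro _
    have : Ph 0 = fun _ => 0 := by ext t; simp [Ph]
    rw [this]
    refine ⟨continuous_const, tendsto_const_nhds, ?_, fun t => ⟨1, by simp⟩⟩
    simp
  | cons a R ih =>
    intro h
    obtain ⟨h1, h2, h3, h4⟩ := ih (fun ρ hρ => h ρ (Multiset.mem_cons_of_mem hρ))
    have ha := h a (Multiset.mem_cons_self a R)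
    have : Ph (a ::ₘ R) = fun t : ℝ => Complex.arg ((t : ℂ) - a) + Ph R t := by
      ext t; exact Ph_cons a R t
    rw [this]
    refine ⟨?_, ?_, ?_, ?_⟩
    · refine Continuous.add ?_ h1
      rw [continuous_iff_continuousAt]
      intro t
      have hc : ContinuousAt Complex.arg ((t : ℂ) - a) := by
        apply Complex.continuousAt_arg
        right
        simpa using ha
      exact ContinuousAt.comp (f := fun t : ℝ => (t : ℂ) - a) hc (by fun_prop)
    · simpa using (arg_atTop a).add h2
    · have := (arg_atBot a ha).add h3
      convert this using 2
      simp; ring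
    · intro t
      obtain ⟨r, hr⟩ := h4 t
      refine ⟨‖(t : ℂ) - a‖ * r, ?_⟩
      rw [Multiset.map_cons, Multiset.prod_cons, hr]
      conv_lhs => rw [← Complex.norm_mul_exp_arg_mul_I ((t : ℂ) - a)]
      push_cast
      rw [add_mul, Complex.exp_add]
      ring

open Filter Topology in
lemma exists_zeros (R : Multiset ℂ) (hR : ∀ ρ ∈ R, ρ.im ≠ 0) (d : ℕ)
    (hd : (d : ℤ) ≤ |(R.map sg).sum|) :
    ∃ T : Finset ℝ, T.card = d ∧ ∀ t ∈ T, ((R.map (fun ρ => (t : ℂ) - ρ)).prod).re = 0 := by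
  obtain ⟨h1, h2, h3, h4⟩ := Ph_props R hR
  set D := (R.map sg).sum
  -- a sign making the total variation positive
  obtain ⟨σ, hσ, hσD⟩ : ∃ σ : ℝ, (σ = 1 ∨ σ = -1) ∧ σ * (D : ℝ) = |(D : ℝ)| := by
    rcases le_total 0 (D : ℝ) with h | h
    · exact ⟨1, Or.inl rfl, by rw [abs_of_nonneg h, one_mul]⟩
    · exact ⟨-1, Or.inr rfl, by rw [abs_of_nonpos h]; ring⟩
  have hd' : (d : ℝ) ≤ |(D : ℝ)| := by exact_mod_cast hd
  have hex : ∀ k : Fin d, ∃ t : ℝ, σ * Ph R t = ((k : ℕ) + 1 / 2 : ℝ) * Real.pi := by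
    intro k
    have hk : ((k : ℕ) : ℝ) + 1 ≤ d := by exact_mod_cast k.2
    have hpi := Real.pi_pos
    have t1 := h2.const_mul σ
    have t2 := h3.const_mul σ
    rw [mul_zero] at t1
    rw [← mul_assoc, hσD] at t2
    have e1 := (t1.eventually (gt_mem_nhds (show (0 : ℝ) < ((k : ℕ) + 1 / 2 : ℝ) * Real.pi by positivity))).exists
    have e2 := (t2.eventually (lt_mem_nhds (show ((k : ℕ) + 1 / 2 : ℝ) * Real.pi < |(D : ℝ)| * Real.pi from
      mul_lt_mul_of_pos_right (by linarith) hpi))).exists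
    obtain ⟨u, hu⟩ := e1
    obtain ⟨v, hv⟩ := e2
    exact mem_range_of_exists_le_of_exists_ge (continuous_const.mul h1) ⟨u, hu.le⟩ ⟨v, hv.le⟩
  choose g hg using hex
  have hinj : Function.Injective g := by
    intro j k hjk
    have := hg j
    rw [hjk, hg k] at this
    have := mul_right_cancel₀ Real.pi_pos.ne' this
    have : ((k : ℕ) : ℝ) = (j : ℕ) := by linarith
    exact Fin.ext (by exact_mod_cast this.symm)
  refine ⟨Finset.univ.map ⟨g, hinj⟩, by simp, ?_⟩
  intro t ht
  simp only [Finset.mem_map, Finset.mem_univ, true_and, Function.Embedding.coeFn_mk] at ht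
  obtain ⟨k, rfl⟩ := ht
  obtain ⟨r, hr⟩ := h4 (g k)
  rw [hr, Complex.re_ofReal_mul, Complex.exp_ofReal_mul_I_re]
  have hc : Real.cos (σ * Ph R (g k)) = 0 := by
    rw [hg k, Real.cos_eq_zero_iff]
    exact ⟨(k : ℕ), by push_cast; ring⟩
  have : Real.cos (Ph R (g k)) = 0 := by
    rcases hσ with h | h
    · rwa [h, one_mul] at hc
    · rwa [h, neg_one_mul, Real.cos_neg] at hc
  rw [this, mul_zero]

lemma sg_abs (ρ : ℂ) : |sg ρ| = 1 := by unfold sg; split_ifs <;> simp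

lemma sg_sum_abs (R : Multiset ℂ) : |(R.map sg).sum| ≤ (R.card : ℤ) := by
  induction R using Multiset.induction_on with
  | empty => simp
  | cons a R ih =>
    rw [Multiset.map_cons, Multiset.sum_cons, Multiset.card_cons]
    have := abs_add_le (sg a) (R.map sg).sum
    rw [sg_abs] at this
    push_cast
    linarith

lemma sg_sum_bound (a : ℂ) (k : ℕ) (R : Multiset ℂ) :
    (k : ℤ) - R.card ≤ |((Multiset.replicate k a + R).map sg).sum| := by
  rw [Multiset.map_add, Multiset.sum_add, Multiset.map_replicate, Multiset.sum_replicate]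
  have h1 := sg_sum_abs R
  have h2 : |k • sg a| = (k : ℤ) := by
    rw [nsmul_eq_mul, abs_mul, sg_abs]; simp
  have h3 := abs_sub_abs_le_abs_sub (k • sg a) (-(R.map sg).sum)
  rw [abs_neg, sub_neg_eq_add, h2] at h3
  linarith

/-! ### The algebraic identity -/

noncomputable def TT (m l : ℕ) (a : ℂ) : Polynomial ℂ :=
  ∑ j ∈ Finset.range (m + 1), C ((Nat.choose (l + j) j : ℂ)) * (X - C a) ^ j * X ^ (m - j)

lemma TT_succ (m l : ℕ) (a : ℂ) :
    TT (m + 1) l a = X * TT m l a + C ((Nat.choose (l + (m + 1)) (m + 1) : ℂ)) * (X - C a) ^ (m + 1) := by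
  unfold TT
  rw [Finset.sum_range_succ, Finset.mul_sum]
  congr 1
  · apply Finset.sum_congr rfl
    intro j hj
    rw [Finset.mem_range] at hj
    rw [show m + 1 - j = (m - j) + 1 by omega, pow_succ]
    ring
  · simp

lemma TT_rec (m l : ℕ) (a : ℂ) :
    C a * TT m (l + 1) a = X * TT m l a - C ((Nat.choose (m + (l + 1)) (l + 1) : ℂ)) * (X - C a) ^ (m + 1) := by
  induction m with
  | zero => simp [TT]
  | succ m ih =>
    rw [TT_succ, TT_succ, mul_add, mul_left_comm, ih]
    have e1 : Nat.choose (l + 1 + (m + 1)) (m + 1) = Nat.choose (l + (m + 1)) (m + 1) + Nat.choose (m + (l + 1)) (l + 1) := by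
      rw [show l + 1 + (m + 1) = (l + (m + 1)) + 1 by ring, Nat.choose_succ_succ, add_comm]
      congr 1
      rw [show l + (m + 1) = m + (l + 1) by ring]
      exact Nat.choose_symm_add
    have e2 : Nat.choose (m + 1 + (l + 1)) (l + 1) = Nat.choose (l + 1 + (m + 1)) (m + 1) := by
      rw [← Nat.choose_symm_add, add_comm]
    rw [e2, e1]
    push_cast
    simp only [map_add]
    ring

lemma f_identity (m l : ℕ) (a : ℂ) :
    X ^ (m + (l + 1)) - f (m + (l + 1)) (l + 1) a = C (a ^ (l + 1)) * TT m l a := by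
  induction l with
  | zero =>
    simp only [f, P, zero_add, Finset.sum_range_one, TT]
    simp
    have := Commute.mul_geom_sum₂ (Commute.all (X : Polynomial ℂ) (X - C a)) (m + 1)
    have h2 : X - (X - C a) = C a := by ring
    rw [h2] at this
    rw [← this, ← Finset.sum_range_reflect]
    congr 1
    apply Finset.sum_congr rfl
    intro j hj
    rw [Finset.mem_range] at hj
    rw [mul_comm]
    congr 2 <;> omega
  | succ l ih =>
    have hf : f (m + (l + 1 + 1)) (l + 1 + 1) a = X * f (m + (l + 1)) (l + 1) a +
        C ((Nat.choose (m + (l + 1)) (l + 1) : ℂ) * a ^ (l + 1)) * (X - C a) ^ (m + 1) := by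
      have hP : P (m + (l + 1 + 1)) (l + 1 + 1) a = X * P (m + (l + 1)) (l + 1) a +
          C ((Nat.choose (m + (l + 1)) (l + 1) : ℂ) * a ^ (l + 1)) := by
        simp only [P, Nat.add_sub_cancel]
        rw [Finset.sum_range_succ, Finset.mul_sum _ _ X, Nat.sub_self, pow_zero, mul_one]
        refine congrArg (· + _) (Finset.sum_congr rfl ?_)
        intro j hj
        rw [Finset.mem_range] at hj
        rw [show l + 1 - j = (l - j) + 1 by omega, pow_succ X (l - j), mul_left_comm X, mul_comm X]
      simp only [f, Nat.add_sub_cancel]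
      rw [hP]
      ring
    have := TT_rec m l a
    have e : C (a ^ (l + 1 + 1)) * TT m (l + 1) a =
        C (a ^ (l + 1)) * (C a * TT m (l + 1) a) := by
      rw [pow_succ a (l + 1), C_mul, mul_assoc]
    rw [hf, e, this, C_mul, mul_sub, mul_left_comm (C (a ^ (l + 1))) X, ← ih]
    ring

lemma TT_natDegree (m l : ℕ) (a : ℂ) : (TT m l a).natDegree = m := by
  have hle : (TT m l a).natDegree ≤ m := by
    unfold TT
    apply natDegree_sum_le_of_forall_le
    intro j hj
    rw [Finset.mem_range] at hj
    compute_degree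
    omega
  apply le_antisymm hle
  apply le_natDegree_of_ne_zero
  have : (TT m l a).coeff m = ((∑ j ∈ Finset.range (m + 1), Nat.choose (l + j) j : ℕ) : ℂ) := by
    unfold TT
    rw [finsetSum_coeff]
    push_cast
    apply Finset.sum_congr rfl
    intro j hj
    rw [Finset.mem_range] at hj
    have hm : ((X - C a) ^ j * X ^ (m - j) : Polynomial ℂ).Monic :=
      ((monic_X_sub_C a).pow j).mul (monic_X_pow _)
    have hdeg : ((X - C a) ^ j * X ^ (m - j) : Polynomial ℂ).natDegree = m := by
      rw [((monic_X_sub_C a).pow j).natDegree_mul (monic_X_pow _), (monic_X_sub_C a).natDegree_pow]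
      simp; omega
    have := hm.coeff_natDegree
    rw [hdeg] at this
    rw [mul_assoc, coeff_C_mul, this, mul_one]
  rw [this, Nat.cast_ne_zero, Finset.sum_range_succ']
  simp

lemma q_natDegree (n ℓ : ℕ) (a : ℂ) (ha : a ≠ 0) (hℓ : 1 ≤ ℓ) (hn : ℓ ≤ n) :
    (X ^ n - f n ℓ a).natDegree = n - ℓ := by
  obtain ⟨l, rfl⟩ : ∃ l, ℓ = l + 1 := ⟨ℓ - 1, by omega⟩
  obtain ⟨m, rfl⟩ : ∃ m, n = m + (l + 1) := ⟨n - (l + 1), by omega⟩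
  rw [f_identity, natDegree_C_mul (pow_ne_zero _ ha), TT_natDegree]
  simp

lemma f_monic (n ℓ : ℕ) (a : ℂ) (ha : a ≠ 0) (hℓ : 1 ≤ ℓ) (hn : ℓ ≤ n) :
    (f n ℓ a).Monic ∧ (f n ℓ a).natDegree = n := by
  have h := q_natDegree n ℓ a ha hℓ hn
  have e : f n ℓ a = X ^ n - (X ^ n - f n ℓ a) := by ring
  have hd : (X ^ n - f n ℓ a).degree < (n : WithBot ℕ) := by
    apply lt_of_le_of_lt degree_le_natDegree
    rw [h]; exact_mod_cast (show n - ℓ < n by omega)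
  have hm : (f n ℓ a).Monic := by
    rw [e]; exact monic_X_pow_sub hd
  refine ⟨hm, ?_⟩
  rw [e]
  apply natDegree_eq_of_degree_eq_some
  rw [degree_sub_eq_left_of_degree_lt] <;> simpa using hd

/-! ### Homogeneity and the choice of `a` -/

lemma f_hom (n ℓ : ℕ) (a w : ℂ) (hℓ : 1 ≤ ℓ) (hn : ℓ ≤ n) :
    (f n ℓ a).eval (a * w) = a ^ n * (f n ℓ 1).eval w := by
  have hP : (P n ℓ a).eval (a * w) = a ^ (ℓ - 1) * (P n ℓ 1).eval w := by
    simp only [P, eval_finsetSum, eval_mul, eval_C, eval_pow, eval_X, Finset.mul_sum]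
    apply Finset.sum_congr rfl
    intro k hk
    rw [Finset.mem_range] at hk
    have : a ^ (ℓ - 1) = a ^ k * a ^ (ℓ - 1 - k) := by rw [← pow_add]; congr 1; omega
    rw [this, mul_pow, one_pow]
    ring
  have : a ^ n = a ^ (n - ℓ + 1) * a ^ (ℓ - 1) := by rw [← pow_add]; congr 1; omega
  simp only [f, eval_mul, eval_pow, eval_sub, eval_X, eval_C]
  rw [hP, this, show a * w - a = a * (w - 1) by ring, mul_pow]
  ring

lemma f_zero_ne (n ℓ : ℕ) (hℓ : 1 ≤ ℓ) : (f n ℓ 1).eval 0 ≠ 0 := by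
  obtain ⟨l, rfl⟩ : ∃ l, ℓ = l + 1 := ⟨ℓ - 1, by omega⟩
  have hP : (P n (l + 1) 1).eval 0 = (Nat.choose (n - (l + 1) + l) l : ℂ) := by
    simp only [P, eval_finsetSum, eval_mul, eval_C, eval_pow, eval_X]
    rw [Finset.sum_range_succ, Finset.sum_eq_zero]
    · simp
    · intro k hk
      rw [Finset.mem_range] at hk
      rw [zero_pow (by omega), mul_zero]
  simp only [f, eval_mul, eval_pow, eval_sub, eval_X, eval_C]
  rw [hP]
  refine mul_ne_zero (pow_ne_zero _ (by simp)) ?_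
  exact_mod_cast (Nat.choose_pos (by omega)).ne'

lemma exists_generic (V : Finset ℂ) (hV : ∀ v ∈ V, v ≠ 0) :
    ∃ b : ℂ, b ≠ 0 ∧ ∀ v ∈ V, (b * v).re ≠ 0 := by
  have hfin : (⋃ v ∈ V, {s : ℝ | v.re - s * v.im = 0}).Finite := by
    apply Set.Finite.biUnion V.finite_toSet
    intro v hv
    apply Set.Subsingleton.finite
    intro s hs t ht
    simp only [Set.mem_ofPred_eq] at hs ht
    have him : v.im ≠ 0 := by
      intro h
      rw [h] at hs
      exact hV v hv (Complex.ext (by simpa using hs) (by simpa using h))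
    exact mul_right_cancel₀ him (by linarith)
  obtain ⟨s, hs⟩ := hfin.exists_notMem
  refine ⟨⟨1, s⟩, fun h => by simpa using congrArg Complex.re h, ?_⟩
  intro v hv h
  apply hs
  simp only [Set.mem_iUnion, Set.mem_ofPred_eq]
  exact ⟨v, hv, by simpa using h⟩

lemma exists_a (n ℓ : ℕ) (hℓ : 1 ≤ ℓ) (hn : ℓ ≤ n) :
    ∃ a : ℂ, a ≠ 0 ∧ ((f n ℓ a).eval 0).im ≠ 0 ∧ ∀ z ∈ (f n ℓ a).roots, (z ^ n).re ≠ 0 := by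
  classical
  have h0 := f_zero_ne n ℓ hℓ
  obtain ⟨b, hb, hbV⟩ := exists_generic
    (insert (-Complex.I * (f n ℓ 1).eval 0) ((f n ℓ 1).roots.toFinset.image (fun w => w ^ n))) (by
      intro v hv
      rw [Finset.mem_insert, Finset.mem_image] at hv
      rcases hv with rfl | ⟨w, hw, rfl⟩
      · simp [h0]
      · apply pow_ne_zero
        rintro rfl
        rw [Multiset.mem_toFinset] at hw
        exact h0 (isRoot_of_mem_roots hw))
  obtain ⟨a, ha⟩ := IsAlgClosed.exists_pow_nat_eq b (show 0 < n by omega)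
  have ha0 : a ≠ 0 := by
    rintro rfl
    rw [zero_pow (by omega)] at ha
    exact hb ha.symm
  refine ⟨a, ha0, ?_, ?_⟩
  · have h1 := hbV _ (Finset.mem_insert_self _ _)
    have h2 := f_hom n ℓ a 0 hℓ hn
    rw [mul_zero, ha] at h2
    rw [h2]
    rw [show b * (-Complex.I * (f n ℓ 1).eval 0) = -Complex.I * (b * (f n ℓ 1).eval 0) by ring] at h1
    simpa using h1
  · intro z hz
    have hz' := isRoot_of_mem_roots hz
    have h2 := f_hom n ℓ a (z / a) hℓ hn
    rw [mul_div_cancel₀ _ ha0, hz'.eq_zero] at h2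
    have h3 : (f n ℓ 1).eval (z / a) = 0 := by
      rcases mul_eq_zero.1 h2.symm with h | h
      · exact absurd h (pow_ne_zero _ ha0)
      · exact h
    have h4 := hbV ((z / a) ^ n) (by
      apply Finset.mem_insert_of_mem
      apply Finset.mem_image_of_mem
      rw [Multiset.mem_toFinset, mem_roots (f_monic n ℓ 1 one_ne_zero hℓ hn).1.ne_zero]
      exact h3)
    rw [← ha, ← mul_pow, mul_div_cancel₀ _ ha0] at h4
    exact h4

lemma mem_S_iff (n ℓ : ℕ) (a z : ℂ) :
    (X ^ n + f n ℓ a).eval z + starRingEnd ℂ ((X ^ n - f n ℓ a).eval z) = 0 ↔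
      (z ^ n).re = 0 ∧ ((f n ℓ a).eval z).im = 0 := by
  simp only [eval_add, eval_sub, eval_pow, eval_X, map_sub]
  rw [Complex.ext_iff]
  simp only [Complex.add_re, Complex.sub_re, Complex.add_im, Complex.sub_im, Complex.conj_re,
    Complex.conj_im, Complex.zero_re, Complex.zero_im]
  constructor
  · rintro ⟨h1, h2⟩
    exact ⟨by linarith, by linarith⟩
  · rintro ⟨h1, h2⟩
    exact ⟨by linarith, by linarith⟩

lemma line_zeros (n ℓ : ℕ) (a ω : ℂ) (ha : a ≠ 0) (hℓ : 1 ≤ ℓ) (hn : 2 * ℓ ≤ n)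
    (hre : ∀ z ∈ (f n ℓ a).roots, (z ^ n).re ≠ 0) (hω : (ω ^ n).re = 0) (hω0 : ω ≠ 0) :
    ∃ T : Finset ℝ, T.card = n + 2 - 2 * ℓ ∧
      ∀ t ∈ T, (((t * ω : ℂ)) ^ n).re = 0 ∧ ((f n ℓ a).eval (t * ω)).im = 0 := by
  obtain ⟨hm, hdeg⟩ := f_monic n ℓ a ha hℓ (by omega)
  have hsp := IsAlgClosed.splits (f n ℓ a)
  have hroots : (f n ℓ a).roots = Multiset.replicate (n - ℓ + 1) a + (P n ℓ a).roots := by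
    have hne := hm.ne_zero
    rw [f] at hne ⊢
    rw [roots_mul hne, roots_pow, roots_X_sub_C, Multiset.nsmul_singleton]
  have hcard : (f n ℓ a).roots.card = n := by
    rw [← hsp.natDegree_eq_card_roots, hdeg]
  have hPc : (P n ℓ a).roots.card = ℓ - 1 := by
    rw [hroots, Multiset.card_add, Multiset.card_replicate] at hcard
    omega
  set R := (f n ℓ a).roots.map (fun z => z / ω) with hR
  have hRe : R = Multiset.replicate (n - ℓ + 1) (a / ω) + (P n ℓ a).roots.map (fun z => z / ω) := by
    rw [hR, hroots, Multiset.map_add, Multiset.map_replicate]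
  have hRim : ∀ ρ ∈ R, ρ.im ≠ 0 := by
    intro ρ hρ him
    rw [hR, Multiset.mem_map] at hρ
    obtain ⟨z, hz, rfl⟩ := hρ
    apply hre z hz
    have h1 : z / ω = (((z / ω).re : ℝ) : ℂ) := Complex.ext (by simp) (by simpa using him)
    have h2 : z = (((z / ω).re : ℝ) : ℂ) * ω := by rw [← h1]; field_simp
    rw [h2, mul_pow, ← Complex.ofReal_pow, Complex.re_ofReal_mul, hω, mul_zero]
  obtain ⟨T, hT, hT'⟩ := exists_zeros R hRim (n + 2 - 2 * ℓ) (by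
    have := sg_sum_bound (a / ω) (n - ℓ + 1) ((P n ℓ a).roots.map (fun z => z / ω))
    rw [← hRe, Multiset.card_map, hPc] at this
    refine le_trans ?_ this
    omega)
  refine ⟨T, hT, fun t ht => ⟨?_, ?_⟩⟩
  · rw [mul_pow, ← Complex.ofReal_pow, Complex.re_ofReal_mul, hω, mul_zero]
  · have h1 : (f n ℓ a).eval (t * ω) = ω ^ n * (R.map (fun ρ => (t : ℂ) - ρ)).prod := by
      rw [hsp.eval_eq_prod_roots, hm.leadingCoeff, one_mul, hR, Multiset.map_map]
      have h2 : (f n ℓ a).roots.map (fun z => (t * ω : ℂ) - z) =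
          (f n ℓ a).roots.map (fun z => ω * ((t : ℂ) - z / ω)) := by
        apply Multiset.map_congr rfl
        intro z _
        field_simp
      rw [h2, Multiset.prod_map_mul, Multiset.map_const', Multiset.prod_replicate, hcard]
      rfl
    rw [h1, Complex.mul_im, hω, hT' t ht]
    ring

lemma S_finite (n ℓ : ℕ) (a : ℂ) (ha : a ≠ 0) (hℓ : 1 ≤ ℓ) (hn : ℓ ≤ n) :
    {z : ℂ | (z ^ n).re = 0 ∧ ((f n ℓ a).eval z).im = 0}.Finite := by
  obtain ⟨hm, hdeg⟩ := f_monic n ℓ a ha hℓ hn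
  have hroot : {ω : ℂ | ω ^ (2 * n) = -1}.Finite := by
    have hne : (X ^ (2 * n) - C (-1) : Polynomial ℂ) ≠ 0 := X_pow_sub_C_ne_zero (by omega) _
    refine ((X ^ (2 * n) - C (-1) : Polynomial ℂ).roots.toFinset.finite_toSet).subset ?_
    intro ω hω
    simp only [Set.mem_ofPred_eq] at hω
    simp only [Finset.mem_coe, Multiset.mem_toFinset]
    rw [mem_roots hne]
    simp [IsRoot, hω]
  have hline : ∀ ω : ℂ, ω ^ (2 * n) = -1 →
      {t : ℝ | ((f n ℓ a).eval (t * ω)).im = 0}.Finite := by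
    intro ω hω
    have hc : (f n ℓ a).coeff n = 1 := by
      have := hm.coeff_natDegree
      rwa [hdeg] at this
    set G : Polynomial ℂ := (f n ℓ a).comp (C ω * X) -
      ((f n ℓ a).map (starRingEnd ℂ)).comp (C (starRingEnd ℂ ω) * X) with hG
    have hne : G ≠ 0 := by
      intro h
      have h1 : G.coeff n = 0 := by rw [h]; simp
      rw [hG, coeff_sub, comp_C_mul_X_coeff, comp_C_mul_X_coeff, coeff_map, hc, map_one,
        one_mul, one_mul, ← map_pow] at h1
      have h2 : (ω ^ n).im = 0 := by
        have := congrArg Complex.im h1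
        simp only [Complex.sub_im, Complex.conj_im, Complex.zero_im] at this
        linarith
      have h3 : (ω ^ n) ^ 2 = -1 := by rw [← pow_mul, mul_comm, hω]
      have h4 := congrArg Complex.re h3
      rw [sq, Complex.mul_re, h2] at h4
      simp at h4
      nlinarith [mul_self_nonneg (ω ^ n).re]
    refine Set.Finite.subset (Set.Finite.preimage (f := fun t : ℝ => (t : ℂ))
      (Complex.ofReal_injective.injOn) G.roots.toFinset.finite_toSet) ?_
    intro t ht
    simp only [Set.mem_ofPred_eq] at ht
    simp only [Set.mem_preimage, Finset.mem_coe, Multiset.mem_toFinset]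
    rw [mem_roots hne, IsRoot, hG, eval_sub, eval_comp, eval_comp]
    simp only [eval_mul, eval_C, eval_X]
    have : (starRingEnd ℂ ω) * (t : ℂ) = starRingEnd ℂ (ω * t) := by simp
    rw [this, eval_map, eval₂_hom, sub_eq_zero, eq_comm, Complex.conj_eq_iff_im, mul_comm]
    exact ht
  refine ((hroot.biUnion (t := fun ω => (fun t : ℝ => (t * ω : ℂ)) ''
    {t : ℝ | ((f n ℓ a).eval (t * ω)).im = 0}) (fun ω hω => (hline ω hω).image _)).union
      (Set.finite_singleton (0 : ℂ))).subset ?_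
  rintro z ⟨h1, h2⟩
  by_cases hz : z = 0
  · right; exact hz
  left
  have hnz : (‖z‖ : ℂ) ≠ 0 := by simpa using hz
  simp only [Set.mem_iUnion, Set.mem_image, Set.mem_ofPred_eq]
  have hzz : (‖z‖ : ℂ) * (z / ‖z‖) = z := mul_div_cancel₀ _ hnz
  refine ⟨z / ‖z‖, ?_, ‖z‖, ?_, hzz⟩
  · have h3 : (z ^ n) ^ 2 = -((‖z‖ : ℂ) ^ n) ^ 2 := by
      have h5 : z ^ n = ((z ^ n).im : ℂ) * Complex.I := Complex.ext (by simp [h1]) (by simp)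
      have h6 : ((z ^ n).im) ^ 2 = (‖z‖ ^ n) ^ 2 := by
        rw [← norm_pow, ← Complex.normSq_eq_norm_sq, Complex.normSq_apply, h1]; ring
      rw [h5, mul_pow, Complex.I_sq, ← Complex.ofReal_pow, h6]
      push_cast; ring
    rw [mul_comm 2 n, pow_mul, div_pow, div_pow, h3, neg_div, div_self]
    exact pow_ne_zero _ (pow_ne_zero _ hnz)
  · rw [hzz]; exact h2

noncomputable def om (n j : ℕ) : ℂ :=
  Complex.exp (((((2 * j + 1) * Real.pi / (2 * n) : ℝ)) : ℂ) * Complex.I)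

lemma om_ne (n j : ℕ) : om n j ≠ 0 := Complex.exp_ne_zero _

lemma om_pow (n j : ℕ) (hn : 0 < n) : ((om n j) ^ n).re = 0 := by
  have hn' : (n : ℝ) ≠ 0 := by positivity
  have : (om n j) ^ n = Complex.exp ((((2 * j + 1) * Real.pi / 2 : ℝ) : ℂ) * Complex.I) := by
    rw [om, ← Complex.exp_nat_mul]
    congr 1
    rw [← mul_assoc]
    congr 1
    have : ((n : ℝ)) * ((2 * j + 1) * Real.pi / (2 * n)) = (2 * j + 1) * Real.pi / 2 := by
      field_simp
    exact_mod_cast this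
  rw [this, Complex.exp_ofReal_mul_I_re, Real.cos_eq_zero_iff]
  exact ⟨j, by push_cast; ring⟩

lemma om_inj_aux (n j k : ℕ) (hjk : j < k) (hk : k < n) (s t : ℝ) (ht : t ≠ 0)
    (h : (s : ℂ) * om n j = t * om n k) : False := by
  have hn' : (0 : ℝ) < n := by exact_mod_cast (by omega : 0 < n)
  have h1 : om n k = Complex.exp (((((k - j : ℝ) * Real.pi / n : ℝ)) : ℂ) * Complex.I) * om n j := by
    rw [om, om, ← Complex.exp_add, ← add_mul]
    congr 2
    rw [← Complex.ofReal_add]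
    congr 1
    field_simp
    ring
  rw [h1, ← mul_assoc] at h
  have h2 := mul_right_cancel₀ (om_ne n j) h
  have h3 := congrArg Complex.im h2
  rw [Complex.im_ofReal_mul, Complex.exp_ofReal_mul_I_im, Complex.ofReal_im] at h3
  have hjk' : (j : ℝ) < k := by exact_mod_cast hjk
  have hk' : (k : ℝ) < n := by exact_mod_cast hk
  have hj0 : (0 : ℝ) ≤ j := by positivity
  have hs : 0 < Real.sin ((k - j : ℝ) * Real.pi / n) := by
    apply Real.sin_pos_of_pos_of_lt_pi
    · have := Real.pi_pos
      have : (0 : ℝ) < k - j := by linarith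
      positivity
    · rw [div_lt_iff₀ hn', mul_comm]
      exact mul_lt_mul_of_pos_left (by linarith) Real.pi_pos
  exact (mul_ne_zero ht hs.ne') h3.symm

theorem lower_bound_aux (n ℓ : ℕ) (hℓ : 1 ≤ ℓ) (hn : 2 * ℓ ≤ n) (a : ℂ) (ha : a ≠ 0)
    (h0 : ((f n ℓ a).eval 0).im ≠ 0) (hre : ∀ z ∈ (f n ℓ a).roots, (z ^ n).re ≠ 0) :
    n * (n + 2 - 2 * ℓ) ≤ {z : ℂ | (z ^ n).re = 0 ∧ ((f n ℓ a).eval z).im = 0}.ncard := by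
  classical
  have hex := fun j : ℕ => line_zeros n ℓ a (om n j) ha hℓ hn hre (om_pow n j (by omega)) (om_ne n j)
  choose T hT hT' using hex
  have hTne : ∀ j, ∀ t ∈ T j, t ≠ 0 := by
    rintro j t ht rfl
    apply h0
    simpa using (hT' j 0 ht).2
  set U : Finset ℂ := (Finset.range n).biUnion
    (fun j => (T j).image (fun t : ℝ => (t : ℂ) * om n j)) with hU
  have hcard : U.card = n * (n + 2 - 2 * ℓ) := by
    rw [hU, Finset.card_biUnion]
    · rw [Finset.sum_congr rfl (g := fun _ => n + 2 - 2 * ℓ)]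
      · simp
      · intro j _
        rw [Finset.card_image_of_injective, hT]
        intro s t hst
        exact Complex.ofReal_injective (mul_right_cancel₀ (om_ne n j) hst)
    · intro j hj k hk hjk
      have hj := Finset.mem_range.1 hj
      have hk := Finset.mem_range.1 hk
      show Disjoint (Finset.image _ _) (Finset.image _ _)
      rw [Finset.disjoint_left]
      intro z hz hz'
      rw [Finset.mem_image] at hz hz'
      obtain ⟨s, hs, rfl⟩ := hz
      obtain ⟨t, ht, hst⟩ := hz'
      rcases lt_or_gt_of_ne hjk with h | h
      · exact om_inj_aux n j k h hk s t (hTne k t ht) hst.symm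
      · exact om_inj_aux n k j h hj t s (hTne j s hs) hst
  rw [← hcard, ← Set.ncard_coe_finset]
  apply Set.ncard_le_ncard _ (S_finite n ℓ a ha hℓ (by omega))
  intro z hz
  rw [Finset.mem_coe, hU, Finset.mem_biUnion] at hz
  obtain ⟨j, _, hz⟩ := hz
  rw [Finset.mem_image] at hz
  obtain ⟨t, ht, rfl⟩ := hz
  exact hT' j t ht

/-- Fix an odd `ℓ ≥ 1`.  There exist `0 < c < 1` and `N` such that for every even `n ≥ N`
there is a nonzero `a : ℂ` for which, with `p(z) = z^n + f_{n,ℓ}(z)` and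
`q(z) = z^n - f_{n,ℓ}(z)` (so `q` has degree `n - ℓ`), the zero set of the harmonic
polynomial `F(z) = p(z) + conj(q(z))` is finite of cardinality `N_F ≥ n² - 2·n·ℓ·(1-c)`. -/
theorem lower_bound_zeros (ℓ : ℕ) (hℓ : 1 ≤ ℓ) (hodd : Odd ℓ) :
    ∃ c : ℝ, 0 < c ∧ c < 1 ∧ ∃ N : ℕ, ∀ n : ℕ, N ≤ n → Even n →
      ∃ a : ℂ, a ≠ 0 ∧ (X ^ n - f n ℓ a).natDegree = n - ℓ ∧
        (let S : Set ℂ :=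
          {z : ℂ | (X ^ n + f n ℓ a).eval z + starRingEnd ℂ ((X ^ n - f n ℓ a).eval z) = 0}
        S.Finite ∧ (n : ℝ) ^ 2 - 2 * n * ℓ * (1 - c) ≤ S.ncard) := by
  have hℓ' : (1 : ℝ) ≤ ℓ := by exact_mod_cast hℓ
  refine ⟨1 / (2 * ℓ), by positivity, ?_, 2 * ℓ, ?_⟩
  · rw [div_lt_one (by positivity)]; linarith
  intro n hn _
  obtain ⟨a, ha, h0, hre⟩ := exists_a n ℓ hℓ (by omega)
  refine ⟨a, ha, q_natDegree n ℓ a ha hℓ (by omega), ?_⟩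
  simp only [mem_S_iff]
  refine ⟨S_finite n ℓ a ha hℓ (by omega), ?_⟩
  have h := lower_bound_aux n ℓ hℓ hn a ha h0 hre
  have h' : ((n * (n + 2 - 2 * ℓ) : ℕ) : ℝ) ≤
      ({z : ℂ | (z ^ n).re = 0 ∧ ((f n ℓ a).eval z).im = 0}.ncard : ℝ) := by exact_mod_cast h
  refine le_trans ?_ h'
  rw [Nat.cast_mul, Nat.cast_sub (by omega)]
  push_cast
  have e : 2 * (n : ℝ) * ℓ * (1 - 1 / (2 * ℓ)) = 2 * n * ℓ - n := by
    field_simp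
  rw [e]
  have : (0 : ℝ) ≤ n := by positivity
  nlinarith
end
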